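/- arXiv:1706.03478 — 6 statements merged into one kernel-verified Lean document; each statement's English description precedes it below -/
import Mathlib

section
/- Let n, d be positive integers with d dividing n, let r, s be integers, and let f be an even function (mod n). If gcd(r, d) = 1, then the sum of f(k − s) over all k with 1 ≤ k ≤ n, gcd(k, n) = 1 and k ≡ r (mod d) equals (φ(n)/φ(d)) · Σ_{e ∣ n, gcd(e,s) = 1, gcd(e,d) ∣ r − s} ((μ∗f)(e)/φ(e)) · φ(gcd(e, d)); and if gcd(r, d) > 1 the sum equals 0. -/
open Finset ArithmeticFunction

/-- The residues coprime to `n` lying in a class `t` coprime to `m ∣ n` number `φ n / φ m`. -/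
theorem card_coprime_modEq_mul_totient {n m : ℕ} (hn : 0 < n) (hm : m ∣ n) {t : ℤ}
    (ht : Int.gcd t m = 1) :
    #{k ∈ Icc 1 n | Nat.gcd k n = 1 ∧ (k : ℤ) ≡ t [ZMOD (m : ℤ)]} * m.totient = n.totient := by
  classical
  have : NeZero n := ⟨hn.ne'⟩
  have : NeZero m := ⟨(Nat.pos_of_dvd_of_pos hm hn).ne'⟩
  have htu : IsUnit (t : ZMod m) := by
    rw [ZMod.coe_int_isUnit_iff_isCoprime]
    exact (Int.isCoprime_iff_gcd_eq_one.2 ht).symm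
  have hsurj := ZMod.unitsMap_surjective hm
  have hfib : #{k ∈ Icc 1 n | Nat.gcd k n = 1 ∧ (k : ℤ) ≡ t [ZMOD (m : ℤ)]} =
      #{u : (ZMod n)ˣ | ZMod.unitsMap hm u = htu.unit} := by
    refine card_bij' (fun k _ => if h : Nat.Coprime k n then ZMod.unitOfCoprime k h else 1)
      (fun u _ => if (u : ZMod n).val = 0 then n else (u : ZMod n).val) ?_ ?_ ?_ ?_
    · intro k hk
      simp only [mem_filter, mem_Icc] at hk
      have h : Nat.Coprime k n := hk.2.1
      rw [dif_pos h, mem_filter]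
      refine ⟨mem_univ _, ?_⟩
      ext
      have := (ZMod.intCast_eq_intCast_iff _ _ _).2 hk.2.2
      simpa [ZMod.unitsMap_val, ZMod.cast_natCast hm] using this
    · intro u hu
      simp only [mem_filter, mem_univ, true_and] at hu
      have hlt := ZMod.val_lt (u : ZMod n)
      have hcast : ((if (u : ZMod n).val = 0 then n else (u : ZMod n).val : ℕ) : ZMod n) = u := by
        split_ifs with h
        · rw [(ZMod.val_eq_zero _).1 h, ZMod.natCast_self]
        · exact ZMod.natCast_zmod_val _
      generalize hkd : (if (u : ZMod n).val = 0 then n else (u : ZMod n).val : ℕ) = k at hcast ⊢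
      simp only [mem_filter, mem_Icc]
      refine ⟨by split_ifs at hkd <;> omega, ?_, ?_⟩
      · exact (ZMod.isUnit_iff_coprime k n).1 (hcast ▸ u.isUnit)
      · rw [← ZMod.intCast_eq_intCast_iff]
        have h2 := congrArg Units.val hu
        rw [ZMod.unitsMap_val, ← hcast] at h2
        simpa [ZMod.cast_natCast hm] using h2
    · intro k hk
      simp only [mem_filter, mem_Icc] at hk
      have h : Nat.Coprime k n := hk.2.1
      simp only [dif_pos h, ZMod.coe_unitOfCoprime, ZMod.val_natCast]
      rcases hk.1.2.eq_or_lt with rfl | hlt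
      · simp
      · rw [Nat.mod_eq_of_lt hlt, if_neg (by omega)]
    · intro u _
      have hcast : ((if (u : ZMod n).val = 0 then n else (u : ZMod n).val : ℕ) : ZMod n) = u := by
        split_ifs with h
        · rw [(ZMod.val_eq_zero _).1 h, ZMod.natCast_self]
        · exact ZMod.natCast_zmod_val _
      have hco := (ZMod.isUnit_iff_coprime _ n).1 (hcast ▸ u.isUnit)
      rw [dif_pos hco]
      exact Units.ext hcast
  have hsum : #(univ : Finset (ZMod n)ˣ) =
      ∑ y : (ZMod m)ˣ, #{u : (ZMod n)ˣ | ZMod.unitsMap hm u = y} :=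
    card_eq_sum_card_fiberwise fun _ _ => mem_coe.2 (mem_univ _)
  rw [hfib, ← ZMod.card_units_eq_totient n, ← ZMod.card_units_eq_totient m, ← card_univ,
    ← card_univ, hsum, mul_comm, ← smul_eq_mul, ← sum_const]
  exact sum_congr rfl fun y _ => MonoidHom.card_fiber_eq_of_mem_range _ (hsurj _) (hsurj _)

theorem totient_lcm_mul_totient_gcd (a b : ℕ) :
    (a.lcm b).totient * (a.gcd b).totient = a.totient * b.totient := by
  rcases Nat.eq_zero_or_pos (a.gcd b) with h0 | hpos
  · obtain ⟨rfl, rfl⟩ := Nat.gcd_eq_zero_iff.1 h0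
    simp
  have h1 := Nat.totient_gcd_mul_totient_mul a b
  have h2 := Nat.totient_gcd_mul_totient_mul (a.gcd b) (a.lcm b)
  rw [Nat.gcd_eq_left ((Nat.gcd_dvd_left a b).trans (Nat.dvd_lcm_left a b)),
    Nat.gcd_mul_lcm, h1] at h2
  rw [mul_comm]
  exact (Nat.eq_of_mul_eq_mul_right hpos h2).symm

/-- Möbius inversion for complex functions restricted to positive naturals. -/
theorem sum_divisors_sum_moebius_mul (g : ℕ → ℂ) {m : ℕ} (hm : 0 < m) :
    ∑ e ∈ m.divisors, ∑ a ∈ e.divisors, (moebius a : ℂ) * g (e / a) = g m := by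
  refine (sum_eq_iff_sum_mul_moebius_eq
    (f := fun e => ∑ a ∈ e.divisors, (moebius a : ℂ) * g (e / a)) (g := g)).2 (fun e _ => ?_) m hm
  exact Nat.sum_divisorsAntidiagonal (fun i j => (moebius i : ℂ) * g j)

/-- Reduced residues mod `n` in prescribed classes mod `d` and mod `e`. -/
theorem card_coprime_modEq_dvd_sub {n d e : ℕ} (hn : 0 < n) (hd : d ∣ n) (he : e ∣ n) {r s : ℤ}
    (hr : Int.gcd r d = 1) :
    (#{k ∈ Icc 1 n | (Nat.gcd k n = 1 ∧ (k : ℤ) ≡ r [ZMOD (d : ℤ)]) ∧ (e : ℤ) ∣ k - s} : ℂ) =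
      if Int.gcd e s = 1 ∧ (Nat.gcd e d : ℤ) ∣ r - s then
        (n.totient : ℂ) / d.totient * ((Nat.gcd e d).totient / e.totient) else 0 := by
  split_ifs with h
  · obtain ⟨hes, hrs⟩ := h
    obtain ⟨t, htr, hts⟩ : ∃ t : ℤ, (d : ℤ) ∣ t - r ∧ (e : ℤ) ∣ t - s := by
      obtain ⟨c, hc⟩ := hrs
      have hb := Nat.gcd_eq_gcd_ab e d
      refine ⟨s + e * (Nat.gcdA e d * c), ⟨-(Nat.gcdB e d * c), ?_⟩, ⟨Nat.gcdA e d * c, by ring⟩⟩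
      rw [hb] at hc
      linear_combination -hc
    have htd : IsCoprime t (d : ℤ) := by
      obtain ⟨c, hc⟩ := htr
      rw [show t = r + d * c by linear_combination hc, IsCoprime.add_mul_left_left_iff]
      exact Int.isCoprime_iff_gcd_eq_one.2 hr
    have hte : IsCoprime t (e : ℤ) := by
      obtain ⟨c, hc⟩ := hts
      rw [show t = s + e * c by linear_combination hc, IsCoprime.add_mul_left_left_iff]
      exact (Int.isCoprime_iff_gcd_eq_one.2 hes).symm
    have htl : Int.gcd t (e.lcm d : ℕ) = 1 := by
      rw [← Int.isCoprime_iff_gcd_eq_one]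
      refine (hte.mul_right htd).of_isCoprime_of_dvd_right ?_
      exact_mod_cast Nat.lcm_dvd_mul e d
    have hcount := card_coprime_modEq_mul_totient hn (Nat.lcm_dvd he hd) htl
    have hset : {k ∈ Icc 1 n | (Nat.gcd k n = 1 ∧ (k : ℤ) ≡ r [ZMOD (d : ℤ)]) ∧
        (e : ℤ) ∣ k - s} =
        {k ∈ Icc 1 n | Nat.gcd k n = 1 ∧ (k : ℤ) ≡ t [ZMOD ((e.lcm d : ℕ) : ℤ)]} := by
      refine filter_congr fun k _ => ?_
      rw [and_assoc]
      refine and_congr_right fun _ => ?_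
      rw [Int.modEq_comm, Int.modEq_iff_dvd, Int.modEq_comm (b := t), Int.modEq_iff_dvd (a := t),
        Int.natCast_dvd (m := e.lcm d), Nat.lcm_dvd_iff, ← Int.natCast_dvd, ← Int.natCast_dvd,
        and_comm, ← dvd_sub_left hts (b := (k : ℤ) - s), ← dvd_sub_left htr (b := (k : ℤ) - r), sub_sub_sub_cancel_right,
        sub_sub_sub_cancel_right]
    rw [hset]
    have hpos {m : ℕ} (hm : m ∣ n) : (m.totient : ℂ) ≠ 0 :=
      Nat.cast_ne_zero.2 (Nat.totient_pos.2 (Nat.pos_of_dvd_of_pos hm hn)).ne'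
    have h1 := congrArg (Nat.cast (R := ℂ)) hcount
    have h2 := congrArg (Nat.cast (R := ℂ)) (totient_lcm_mul_totient_gcd e d)
    push_cast at h1 h2
    have hd0 := hpos hd
    have he0 := hpos he
    have hl0 := hpos (Nat.lcm_dvd he hd)
    field_simp
    rw [← h1]
    linear_combination (-_ : ℂ) * h2
  · rw [Nat.cast_eq_zero, card_eq_zero, filter_eq_empty_iff]
    rintro k - ⟨⟨hk, hkr⟩, hks⟩
    refine h ⟨?_, ?_⟩
    · have hke : IsCoprime (k : ℤ) e :=
        Nat.isCoprime_iff_coprime.2 (Nat.Coprime.coprime_dvd_right he hk)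
      obtain ⟨c, hc⟩ := hks
      rw [show (k : ℤ) = s + e * c by linear_combination hc,
        IsCoprime.add_mul_left_left_iff] at hke
      exact Int.isCoprime_iff_gcd_eq_one.1 hke.symm
    · have h1 : (Nat.gcd e d : ℤ) ∣ r - k :=
        (Int.natCast_dvd_natCast.2 (Nat.gcd_dvd_right e d)).trans hkr.dvd
      have h2 : (Nat.gcd e d : ℤ) ∣ k - s :=
        (Int.natCast_dvd_natCast.2 (Nat.gcd_dvd_left e d)).trans hks
      simpa using h1.add h2

/-- **Theorem 1 (Menon-type identity for even functions (mod n))**.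
Let `n, d` be positive integers with `d ∣ n`, let `r, s` be integers, and let `f` be an
even function (mod `n`), i.e. `f (gcd k n) = f k` for all integers `k`.  If `gcd r d = 1`, then
`∑_{1 ≤ k ≤ n, (k,n)=1, k ≡ r (mod d)} f (k - s)
  = (φ n / φ d) · ∑_{e ∣ n, (e,s)=1, (e,d) ∣ r - s} ((μ∗f)(e) / φ e) · φ (gcd e d)`,
and if `gcd r d > 1` the sum equals `0`. -/
theorem menon_even_function_mod_n (n d : ℕ) (hn : 0 < n) (hd : d ∣ n) (r s : ℤ)
    (f : ℤ → ℂ) (hf : ∀ k : ℤ, f ((Int.gcd k (n : ℤ) : ℕ) : ℤ) = f k) :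
    (Int.gcd r (d : ℤ) = 1 →
      ∑ k ∈ (Finset.Icc 1 n).filter
          (fun k => Nat.gcd k n = 1 ∧ (k : ℤ) ≡ r [ZMOD (d : ℤ)]),
        f ((k : ℤ) - s)
      = ((Nat.totient n : ℂ) / (Nat.totient d : ℂ)) *
        ∑ e ∈ n.divisors.filter
            (fun (e : ℕ) => Int.gcd (e : ℤ) s = 1 ∧ ((Nat.gcd e d : ℤ) ∣ r - s)),
          ((∑ a ∈ e.divisors, (moebius a : ℂ) * f ((e / a : ℕ) : ℤ)) / (Nat.totient e : ℂ)) *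
            (Nat.totient (Nat.gcd e d) : ℂ)) ∧
    (1 < Int.gcd r (d : ℤ) →
      ∑ k ∈ (Finset.Icc 1 n).filter
          (fun k => Nat.gcd k n = 1 ∧ (k : ℤ) ≡ r [ZMOD (d : ℤ)]),
        f ((k : ℤ) - s) = 0) := by
  constructor
  · intro hr
    have hexp (k : ℤ) : f k = ∑ e ∈ n.divisors, if (e : ℤ) ∣ k then
        ∑ a ∈ e.divisors, (moebius a : ℂ) * f ((e / a : ℕ) : ℤ) else 0 := by
      have hg : 0 < Int.gcd k n := Int.gcd_pos_of_ne_zero_right _ (by exact_mod_cast hn.ne')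
      rw [← hf k, ← sum_divisors_sum_moebius_mul (fun m => f (m : ℤ)) hg, ← sum_filter]
      refine sum_congr ?_ fun _ _ => rfl
      ext e
      rw [Nat.mem_divisors, mem_filter, Nat.mem_divisors, ← Int.natCast_dvd_natCast, Int.dvd_coe_gcd_iff]
      simp [Int.natCast_dvd_natCast, hg.ne', hn.ne', and_comm]
    simp_rw [hexp (_ - s)]
    rw [sum_comm, sum_filter, mul_sum]
    refine sum_congr rfl fun e he => ?_
    rw [← sum_filter, filter_filter, sum_const, nsmul_eq_mul,
      card_coprime_modEq_dvd_sub hn hd (Nat.dvd_of_mem_divisors he) hr]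
    split_ifs <;> ring
  · intro hr
    rw [filter_false_of_mem, sum_empty]
    rintro k - ⟨hk, hkr⟩
    have hkd : IsCoprime (k : ℤ) d :=
      Nat.isCoprime_iff_coprime.2 (Nat.Coprime.coprime_dvd_right hd hk)
    obtain ⟨c, hc⟩ := hkr.dvd
    rw [show (k : ℤ) = r + d * (-c) by linear_combination -hc,
      IsCoprime.add_mul_left_left_iff, Int.isCoprime_iff_gcd_eq_one] at hkd
    omega
end

section
/- Let n, d be positive integers with d dividing n, and let r, s be integers. If gcd(r, d) = 1, then Σ_{1 ≤ k ≤ n, gcd(k,n)=1, k ≡ r (mod d)} gcd(k − s, n) = (φ(n)/φ(d)) · Σ_{e ∣ n, gcd(e,s)=1, gcd(e,d) ∣ r − s} φ(gcd(e, d)); and if gcd(r, d) > 1 the left-hand sum equals 0. -/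
open Finset

theorem Nat.totient_gcd_mul_totient_lcm (a b : ℕ) (ha : 0 < a) :
    Nat.totient (Nat.gcd a b) * Nat.totient (Nat.lcm a b) = Nat.totient a * Nat.totient b := by
  have hg : 0 < Nat.gcd a b := Nat.gcd_pos_of_pos_left b ha
  have h₁ := Nat.totient_gcd_mul_totient_mul a b
  have h₂ := Nat.totient_gcd_mul_totient_mul (Nat.gcd a b) (Nat.lcm a b)
  rw [Nat.gcd_eq_left ((Nat.gcd_dvd_left a b).trans (Nat.dvd_lcm_left a b)),
    Nat.gcd_mul_lcm, h₁] at h₂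
  exact (Nat.eq_of_mul_eq_mul_right hg h₂).symm

theorem ZMod.totient_mul_card_fiber_unitsMap {n m : ℕ} [NeZero n] [NeZero m] (hm : m ∣ n)
    (b : (ZMod m)ˣ) :
    Nat.totient m * #{u : (ZMod n)ˣ | ZMod.unitsMap hm u = b} = Nat.totient n := by
  have hs := ZMod.unitsMap_surjective hm
  have h := Finset.card_eq_sum_card_fiberwise (f := ZMod.unitsMap hm)
    (s := Finset.univ) (t := Finset.univ) (fun _ _ => Finset.mem_coe.2 (Finset.mem_univ _))
  rw [Finset.sum_congr rfl fun c _ => MonoidHom.card_fiber_eq_of_mem_range (ZMod.unitsMap hm)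
    (hs c) (hs b)] at h
  simpa [ZMod.card_units_eq_totient] using h.symm

theorem Nat.totient_mul_card_coprime_modEq {n m : ℕ} (hn : 0 < n) (hm : m ∣ n) {a : ℤ}
    (ha : Int.gcd a (m : ℤ) = 1) :
    Nat.totient m * #{k ∈ Finset.Icc 1 n | Nat.gcd k n = 1 ∧ (k : ℤ) ≡ a [ZMOD (m : ℤ)]} =
      Nat.totient n := by
  have : NeZero n := ⟨hn.ne'⟩
  have : NeZero m := ⟨(Nat.pos_of_dvd_of_pos hm hn).ne'⟩
  have hu : IsUnit (a : ZMod m) := (ZMod.coe_int_isUnit_iff_isCoprime a m).2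
    (Int.isCoprime_iff_gcd_eq_one.2 (by rwa [Int.gcd_comm]))
  rw [← ZMod.totient_mul_card_fiber_unitsMap hm hu.unit]
  congr 1
  have hp : Function.Periodic
      (fun k : ℕ => Nat.gcd k n = 1 ∧ (k : ℤ) ≡ a [ZMOD (m : ℤ)]) n := by
    intro k
    simp only [Nat.gcd_add_self_left, ← ZMod.intCast_eq_intCast_iff, Nat.cast_add, Int.cast_add,
      Int.cast_natCast, (ZMod.natCast_eq_zero_iff n m).2 hm, add_zero]
  have hI : Finset.Icc 1 n = Finset.Ico 1 (1 + n) := by ext; simp; omega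
  rw [hI, Nat.filter_Ico_card_eq_of_periodic _ _ _ hp, Nat.count_eq_card_filter_range]
  refine Finset.card_bij' (fun k hk => ZMod.unitOfCoprime k (Finset.mem_filter.1 hk).2.1)
    (fun u _ => (u : ZMod n).val) ?_ ?_ ?_ ?_
  · intro k hk
    have h := (ZMod.intCast_eq_intCast_iff _ _ _).2 (Finset.mem_filter.1 hk).2.2
    simp only [Finset.mem_filter, Finset.mem_univ, true_and]
    ext
    simpa [ZMod.unitsMap_def] using h
  · intro u hu'
    simp only [Finset.mem_filter, Finset.mem_univ, true_and] at hu'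
    simp only [Finset.mem_filter, Finset.mem_range]
    refine ⟨ZMod.val_lt _, ZMod.val_coe_unit_coprime u, ?_⟩
    rw [← ZMod.intCast_eq_intCast_iff]
    have h := congrArg Units.val hu'
    rw [ZMod.unitsMap_def, Units.coe_map, MonoidHom.coe_coe, ZMod.castHom_apply,
      ZMod.cast_eq_val] at h
    rw [Int.cast_natCast, h, IsUnit.unit_spec]
  · intro k hk
    simpa using Nat.mod_eq_of_lt (Finset.mem_range.1 (Finset.mem_filter.1 hk).1)
  · intro u _
    ext
    simp

theorem Int.gcd_eq_one_of_modEq {a b m : ℤ} (h : a ≡ b [ZMOD m]) (ha : Int.gcd a m = 1) :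
    Int.gcd b m = 1 := by
  obtain ⟨c, hc⟩ := Int.modEq_iff_dvd.1 h
  rw [← ha, eq_add_of_sub_eq' hc]
  simp

theorem Nat.totient_mul_card_coprime_modEq_modEq {n d e : ℕ} (hn : 0 < n) (hd : d ∣ n)
    (he : e ∣ n) {r s : ℤ} (hr : Int.gcd r (d : ℤ) = 1) :
    Nat.totient d * (Nat.totient e * #{k ∈ Finset.Icc 1 n |
        (Nat.gcd k n = 1 ∧ (k : ℤ) ≡ r [ZMOD (d : ℤ)]) ∧ (e : ℤ) ∣ (k : ℤ) - s}) =
      if Int.gcd (e : ℤ) s = 1 ∧ ((Nat.gcd e d : ℤ) ∣ r - s) then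
        Nat.totient n * Nat.totient (Nat.gcd e d) else 0 := by
  split_ifs with h
  · obtain ⟨hs, hg⟩ := h
    obtain ⟨x, y, hxy⟩ : ∃ x y : ℤ, r - s = e * x + d * y := by
      obtain ⟨c, hc⟩ := hg
      rw [Nat.gcd_eq_gcd_ab] at hc
      exact ⟨Nat.gcdA e d * c, Nat.gcdB e d * c, by rw [hc]; ring⟩
    set a : ℤ := s + e * x with ha
    have har : a ≡ r [ZMOD (d : ℤ)] := Int.modEq_iff_dvd.2 ⟨y, by linarith⟩
    have has : a ≡ s [ZMOD (e : ℤ)] := Int.modEq_iff_dvd.2 ⟨-x, by rw [ha]; ring⟩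
    have had : IsCoprime a (d : ℤ) :=
      Int.isCoprime_iff_gcd_eq_one.2 (Int.gcd_eq_one_of_modEq har.symm hr)
    have hae : IsCoprime a (e : ℤ) := Int.isCoprime_iff_gcd_eq_one.2
      (Int.gcd_eq_one_of_modEq has.symm (by rwa [Int.gcd_comm]))
    have hal : Int.gcd a (Nat.lcm e d : ℕ) = 1 := by
      refine Int.isCoprime_iff_gcd_eq_one.1 ((hae.mul_right had).of_isCoprime_of_dvd_right ?_)
      exact_mod_cast Nat.lcm_dvd_mul e d
    have key := Nat.totient_mul_card_coprime_modEq hn (Nat.lcm_dvd he hd) hal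
    have hset : ({k ∈ Finset.Icc 1 n |
        (Nat.gcd k n = 1 ∧ (k : ℤ) ≡ r [ZMOD (d : ℤ)]) ∧ (e : ℤ) ∣ (k : ℤ) - s} : Finset ℕ) =
        {k ∈ Finset.Icc 1 n | Nat.gcd k n = 1 ∧ (k : ℤ) ≡ a [ZMOD (Nat.lcm e d : ℕ)]} := by
      refine Finset.filter_congr fun k _ => ?_
      rw [and_assoc]
      refine and_congr_right fun _ => ?_
      have hl : (k : ℤ) ≡ a [ZMOD (Nat.lcm e d : ℕ)] ↔
          (k : ℤ) ≡ a [ZMOD (e : ℤ)] ∧ (k : ℤ) ≡ a [ZMOD (d : ℤ)] := by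
        simp only [Int.modEq_iff_dvd, Int.natCast_dvd, Nat.lcm_dvd_iff]
      rw [hl, ← Int.modEq_iff_dvd]
      exact ⟨fun h => ⟨h.2.symm.trans has.symm, h.1.trans har.symm⟩,
        fun h => ⟨h.2.trans har, (h.1.trans has).symm⟩⟩
    have hφ := Nat.totient_gcd_mul_totient_lcm e d (Nat.pos_of_dvd_of_pos he hn)
    rw [hset, ← key, ← mul_assoc, mul_comm (Nat.totient d), ← hφ]
    ring
  · rw [mul_eq_zero, mul_eq_zero, Finset.card_eq_zero, Finset.filter_eq_empty_iff]
    refine Or.inr (Or.inr fun k _ ⟨⟨hk, hkr⟩, hks⟩ => h ⟨?_, ?_⟩)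
    · rw [Int.gcd_comm]
      refine Int.gcd_eq_one_of_modEq (Int.modEq_iff_dvd.2 hks).symm ?_
      rw [Int.gcd_natCast_natCast]
      exact Nat.Coprime.coprime_dvd_right he hk
    · have h₁ : (Nat.gcd e d : ℤ) ∣ r - k :=
        (Int.natCast_dvd_natCast.2 (Nat.gcd_dvd_right e d)).trans (Int.modEq_iff_dvd.1 hkr)
      have h₂ : (Nat.gcd e d : ℤ) ∣ k - s :=
        (Int.natCast_dvd_natCast.2 (Nat.gcd_dvd_left e d)).trans hks
      simpa using dvd_add h₁ h₂

theorem Int.gcd_natCast_right_eq_sum_totient {n : ℕ} (hn : 0 < n) (z : ℤ) :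
    Int.gcd z (n : ℤ) = ∑ e ∈ n.divisors, if (e : ℤ) ∣ z then Nat.totient e else 0 := by
  rw [← Finset.sum_filter]
  conv_lhs => rw [← Nat.sum_totient (Int.gcd z n)]
  refine Finset.sum_congr ?_ fun _ _ => rfl
  ext e
  have hg : Int.gcd z n ≠ 0 := by simp [Int.gcd_eq_zero_iff, hn.ne']
  simp only [Nat.mem_divisors, Finset.mem_filter, Int.dvd_gcd_iff, hg, hn.ne', ne_eq,
    not_false_eq_true, and_true, Int.natCast_dvd_natCast]
  exact and_comm

/-- **Corollary (generalized Menon identity)**.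
Let `n, d` be positive integers with `d ∣ n` and let `r, s` be integers.  If `gcd r d = 1`, then
`∑_{1 ≤ k ≤ n, (k,n)=1, k ≡ r (mod d)} gcd (k - s) n
  = (φ n / φ d) · ∑_{e ∣ n, (e,s)=1, (e,d) ∣ r - s} φ (gcd e d)`,
and if `gcd r d > 1` the sum equals `0`. -/
theorem menon_gcd_identity (n d : ℕ) (hn : 0 < n) (hd : d ∣ n) (r s : ℤ) :
    (Int.gcd r (d : ℤ) = 1 →
      (∑ k ∈ (Finset.Icc 1 n).filter
          (fun k => Nat.gcd k n = 1 ∧ (k : ℤ) ≡ r [ZMOD (d : ℤ)]),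
        (Int.gcd ((k : ℤ) - s) (n : ℤ) : ℚ))
      = ((Nat.totient n : ℚ) / (Nat.totient d : ℚ)) *
        ∑ e ∈ n.divisors.filter
            (fun (e : ℕ) => Int.gcd (e : ℤ) s = 1 ∧ ((Nat.gcd e d : ℤ) ∣ r - s)),
          (Nat.totient (Nat.gcd e d) : ℚ)) ∧
    (1 < Int.gcd r (d : ℤ) →
      (∑ k ∈ (Finset.Icc 1 n).filter
          (fun k => Nat.gcd k n = 1 ∧ (k : ℤ) ≡ r [ZMOD (d : ℤ)]),
        (Int.gcd ((k : ℤ) - s) (n : ℤ) : ℚ)) = 0) := by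
  have hd₀ : 0 < d := Nat.pos_of_dvd_of_pos hd hn
  refine ⟨fun hr => ?_, fun hr => ?_⟩
  · have hφ : (Nat.totient d : ℚ) ≠ 0 := by exact_mod_cast (Nat.totient_pos.2 hd₀).ne'
    rw [div_mul_eq_mul_div, eq_div_iff hφ, mul_comm]
    norm_cast
    simp_rw [Int.gcd_natCast_right_eq_sum_totient hn]
    rw [Finset.sum_comm, Finset.mul_sum, Finset.mul_sum, Finset.sum_filter]
    refine Finset.sum_congr rfl fun e he => ?_
    rw [← Nat.totient_mul_card_coprime_modEq_modEq hn hd (Nat.dvd_of_mem_divisors he) hr,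
      ← Finset.sum_filter, Finset.filter_filter, Finset.sum_const, smul_eq_mul,
      mul_comm (Finset.card _)]
  · rw [Finset.filter_eq_empty_iff.2, Finset.sum_empty]
    rintro k - ⟨hk, hkr⟩
    refine hr.ne' (Int.gcd_eq_one_of_modEq hkr ?_)
    rw [Int.gcd_natCast_natCast]
    exact Nat.Coprime.coprime_dvd_right hd hk
end

section
/- Let n be a positive integer, s an integer, and k ranging over 1 ≤ k ≤ n with gcd(k, n) = 1. Then Σ_{1 ≤ k ≤ n, gcd(k,n)=1} c_n(k − s) = φ(n) · Σ_{e ∣ n, gcd(e,s)=1} e·μ(n/e)/φ(e), and this common value also equals μ(n)·c_n(s) (the Brauer–Rademacher identity). -/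
open Finset ArithmeticFunction

/-- The Ramanujan sum `c_n(k) = ∑_{e ∣ gcd(k,n)} e · μ(n/e)`. -/
def ramanujanSum (n : ℕ) (k : ℤ) : ℤ :=
  ∑ e ∈ (Int.gcd k (n : ℤ)).divisors, (e : ℤ) * moebius (n / e)

/-- The arithmetic function `e ↦ e / φ e` restricted to `e` coprime to `s`. -/
def coprimeDivTotient (s : ℤ) : ArithmeticFunction ℚ :=
  ⟨fun e => if Int.gcd (e : ℤ) s = 1 then (e : ℚ) / (Nat.totient e : ℚ) else 0, by simp⟩

/-- The identity arithmetic function restricted to the divisors of `s`. -/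
def idOnDivisors (s : ℤ) : ArithmeticFunction ℚ :=
  ⟨fun e => if (e : ℤ) ∣ s then (e : ℚ) else 0, by simp⟩

/-- Euler's totient as a rational-valued arithmetic function. -/
def totientRat : ArithmeticFunction ℚ :=
  ⟨fun e => (Nat.totient e : ℚ), by simp⟩

lemma coprimeDivTotient_apply (s : ℤ) (e : ℕ) : coprimeDivTotient s e =
    if Int.gcd (e : ℤ) s = 1 then (e : ℚ) / (Nat.totient e : ℚ) else 0 := rfl

lemma idOnDivisors_apply (s : ℤ) (e : ℕ) :
    idOnDivisors s e = if (e : ℤ) ∣ s then (e : ℚ) else 0 := rfl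

lemma totientRat_apply (e : ℕ) : totientRat e = (Nat.totient e : ℚ) := rfl

lemma isMultiplicative_coprimeDivTotient (s : ℤ) : (coprimeDivTotient s).IsMultiplicative := by
  refine ⟨by simp [coprimeDivTotient_apply], fun {m n} hmn => ?_⟩
  have h : Int.gcd ((m * n : ℕ) : ℤ) s = 1 ↔ Int.gcd (m : ℤ) s = 1 ∧ Int.gcd (n : ℤ) s = 1 := by
    simp only [← Int.isCoprime_iff_gcd_eq_one, Nat.cast_mul, IsCoprime.mul_left_iff]
  rw [coprimeDivTotient_apply, coprimeDivTotient_apply, coprimeDivTotient_apply,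
    Nat.totient_mul hmn, if_congr h rfl rfl]
  by_cases hm : Int.gcd (m : ℤ) s = 1 <;> by_cases hn : Int.gcd (n : ℤ) s = 1 <;>
    simp [hm, hn, mul_div_mul_comm]

lemma isMultiplicative_idOnDivisors (s : ℤ) : (idOnDivisors s).IsMultiplicative := by
  refine ⟨by simp [idOnDivisors_apply], fun {m n} hmn => ?_⟩
  have h : ((m * n : ℕ) : ℤ) ∣ s ↔ (m : ℤ) ∣ s ∧ (n : ℤ) ∣ s := by
    rw [Nat.cast_mul]
    exact ⟨fun h => ⟨dvd_of_mul_right_dvd h, dvd_of_mul_left_dvd h⟩,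
      fun h => (Nat.isCoprime_iff_coprime.mpr hmn).mul_dvd h.1 h.2⟩
  rw [idOnDivisors_apply, idOnDivisors_apply, idOnDivisors_apply, if_congr h rfl rfl]
  by_cases hm : (m : ℤ) ∣ s <;> by_cases hn : (n : ℤ) ∣ s <;> simp [hm, hn]

lemma isMultiplicative_totientRat : totientRat.IsMultiplicative :=
  ⟨by simp [totientRat_apply], fun {m n} hmn => by simp [totientRat_apply, Nat.totient_mul hmn]⟩

lemma mul_moebius_apply_prime_pow_succ (f : ArithmeticFunction ℚ) {p : ℕ} (hp : p.Prime) (a : ℕ) :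
    (f * ((moebius : ArithmeticFunction ℤ) : ArithmeticFunction ℚ)) (p ^ (a + 1)) =
      f (p ^ (a + 1)) - f (p ^ a) := by
  rw [mul_comm, ArithmeticFunction.mul_apply,
    Nat.sum_divisorsAntidiagonal (fun x y =>
      ((moebius : ArithmeticFunction ℤ) : ArithmeticFunction ℚ) x * f y),
    Nat.sum_divisors_prime_pow hp, Finset.sum_range_succ', Finset.sum_range_succ',
    Finset.sum_eq_zero]
  · have h : p ^ (a + 1) / p = p ^ a := by
      rw [pow_succ, Nat.mul_div_cancel _ hp.pos]
    simp [moebius_apply_prime hp, h]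
    ring
  · intro i _
    rw [intCoe_apply, moebius_apply_prime_pow hp (by omega)]
    simp

lemma totientRat_pmul_eq_moebius_pmul (s : ℤ) :
    totientRat.pmul
        (coprimeDivTotient s * ((moebius : ArithmeticFunction ℤ) : ArithmeticFunction ℚ)) =
      ((moebius : ArithmeticFunction ℤ) : ArithmeticFunction ℚ).pmul
        (idOnDivisors s * ((moebius : ArithmeticFunction ℤ) : ArithmeticFunction ℚ)) := by
  have hμ : ((moebius : ArithmeticFunction ℤ) : ArithmeticFunction ℚ).IsMultiplicative :=
    isMultiplicative_moebius.intCast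
  have hL := isMultiplicative_totientRat.pmul ((isMultiplicative_coprimeDivTotient s).mul hμ)
  have hR := hμ.pmul ((isMultiplicative_idOnDivisors s).mul hμ)
  rw [IsMultiplicative.eq_iff_eq_on_prime_powers _ hL _ hR]
  intro p i hp
  have hp1 : (p : ℚ) - 1 ≠ 0 := sub_ne_zero.mpr (by exact_mod_cast hp.one_lt.ne')
  have hp0 : (p : ℚ) ≠ 0 := by exact_mod_cast hp.ne_zero
  rcases i with _ | _ | a
  · rw [pow_zero, hL.map_one, hR.map_one]
  · have hgcd : Int.gcd (p : ℤ) s = 1 ↔ ¬ (p : ℤ) ∣ s := by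
      rw [← Int.isCoprime_iff_gcd_eq_one]
      exact (Nat.prime_iff_prime_int.mp hp).coprime_iff_not_dvd
    simp only [pmul_apply, mul_moebius_apply_prime_pow_succ _ hp]
    by_cases h : (p : ℤ) ∣ s
    · simp [coprimeDivTotient_apply, idOnDivisors_apply, totientRat_apply, hgcd, h,
        moebius_apply_prime hp, Nat.totient_prime hp, Nat.cast_sub hp.one_le]
    · simp [coprimeDivTotient_apply, idOnDivisors_apply, totientRat_apply, hgcd, h,
        moebius_apply_prime hp, Nat.totient_prime hp, Nat.cast_sub hp.one_le]
      field_simp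
      ring
  · have hgcd (b : ℕ) : Int.gcd ((p ^ (b + 1) : ℕ) : ℤ) s = 1 ↔ Int.gcd (p : ℤ) s = 1 := by
      rw [← Int.isCoprime_iff_gcd_eq_one, ← Int.isCoprime_iff_gcd_eq_one, Nat.cast_pow,
        IsCoprime.pow_left_iff (Nat.succ_pos b)]
    have hF (b : ℕ) : coprimeDivTotient s (p ^ (b + 1)) = coprimeDivTotient s p := by
      rw [coprimeDivTotient_apply, coprimeDivTotient_apply, if_congr (hgcd b) rfl rfl,
        Nat.totient_prime_pow_succ hp, Nat.totient_prime hp]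
      push_cast [Nat.cast_sub hp.one_le]
      congr 1
      field_simp
      ring
    simp only [pmul_apply, mul_moebius_apply_prime_pow_succ _ hp, hF, intCoe_apply]
    rw [moebius_apply_prime_pow hp (by omega)]
    simp

lemma card_units_fiber_mul_totient {n e : ℕ} [NeZero n] (he : e ∣ n) (v : (ZMod e)ˣ) :
    #{u : (ZMod n)ˣ | ZMod.unitsMap he u = v} * Nat.totient e = Nat.totient n := by
  have : NeZero e := ⟨fun h => NeZero.ne n (Nat.eq_zero_of_zero_dvd (h ▸ he))⟩
  have hs := ZMod.unitsMap_surjective he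
  have h := Finset.card_eq_sum_card_fiberwise (f := ZMod.unitsMap he) (s := Finset.univ)
    (t := Finset.univ) (fun _ _ => by simp)
  rw [Finset.sum_congr rfl (fun w _ =>
    MonoidHom.card_fiber_eq_of_mem_range (ZMod.unitsMap he) (hs w) (hs v))] at h
  rw [Finset.sum_const, Finset.card_univ, Finset.card_univ, ZMod.card_units_eq_totient,
    ZMod.card_units_eq_totient, smul_eq_mul] at h
  rw [h, mul_comm]

lemma card_coprime_congr_eq_card_units_fiber {n e : ℕ} [NeZero n] (he : e ∣ n) (s : ℤ)
    (v : (ZMod e)ˣ) (hv : (v : ZMod e) = s) :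
    #{k ∈ Finset.Icc 1 n | Nat.gcd k n = 1 ∧ (e : ℤ) ∣ (k : ℤ) - s} =
      #{u : (ZMod n)ˣ | ZMod.unitsMap he u = v} := by
  have hiff (k : ℕ) : (e : ℤ) ∣ (k : ℤ) - s ↔ (k : ZMod e) = v := by
    rw [hv, ← ZMod.intCast_zmod_eq_zero_iff_dvd, Int.cast_sub, sub_eq_zero, Int.cast_natCast]
  refine Finset.card_bij
    (fun k hk => ZMod.unitOfCoprime k (Finset.mem_filter.mp hk).2.1) ?_ ?_ ?_
  · intro k hk
    have h := (hiff k).mp (Finset.mem_filter.mp hk).2.2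
    simp only [Finset.mem_filter, Finset.mem_univ, true_and]
    ext
    rw [ZMod.unitsMap_val, ZMod.coe_unitOfCoprime, ZMod.cast_natCast he, h]
  · intro a ha b hb hab
    have hab' : (a : ZMod n) = b := congrArg Units.val hab
    rw [ZMod.natCast_eq_natCast_iff] at hab'
    simp only [Finset.mem_filter, Finset.mem_Icc] at ha hb
    have hd := (Nat.modEq_iff_dvd.mp hab')
    have h0 := Int.eq_zero_of_abs_lt_dvd hd (by rw [abs_lt]; omega)
    omega
  · intro u hu
    simp only [Finset.mem_filter, Finset.mem_univ, true_and] at hu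
    obtain ⟨k, hk, hku⟩ : ∃ k ∈ Finset.Icc 1 n, (k : ZMod n) = u := by
      by_cases h0 : (u : ZMod n).val = 0
      · refine ⟨n, by simp [Nat.one_le_iff_ne_zero, NeZero.ne n], ?_⟩
        rw [ZMod.natCast_self, (ZMod.val_eq_zero _).mp h0]
      · exact ⟨(u : ZMod n).val, by simp [Nat.one_le_iff_ne_zero, h0, (ZMod.val_lt _).le],
          ZMod.natCast_zmod_val _⟩
    have hc : Nat.gcd k n = 1 := (ZMod.isUnit_iff_coprime k n).mp (hku ▸ u.isUnit)
    refine ⟨k, Finset.mem_filter.mpr ⟨hk, hc, (hiff k).mpr ?_⟩, Units.ext hku⟩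
    rw [← hu, ZMod.unitsMap_val, ← hku, ZMod.cast_natCast he]

lemma card_coprime_congr {n e : ℕ} (hn : 0 < n) (he : e ∣ n) (s : ℤ) :
    (#{k ∈ Finset.Icc 1 n | Nat.gcd k n = 1 ∧ (e : ℤ) ∣ (k : ℤ) - s} : ℚ) =
      if Int.gcd (e : ℤ) s = 1 then (Nat.totient n : ℚ) / Nat.totient e else 0 := by
  have : NeZero n := ⟨hn.ne'⟩
  split_ifs with h
  · have hu : IsUnit (s : ZMod e) := by
      obtain ⟨a, b, hab⟩ := Int.isCoprime_iff_gcd_eq_one.mpr h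
      refine IsUnit.of_mul_eq_one (b : ZMod e) ?_
      have := congrArg (Int.cast : ℤ → ZMod e) hab
      push_cast at this
      rw [ZMod.natCast_self, mul_zero, zero_add] at this
      rw [mul_comm, this]
    have hpos : (Nat.totient e : ℚ) ≠ 0 := by
      exact_mod_cast (Nat.totient_pos.mpr (Nat.pos_of_dvd_of_pos he hn)).ne'
    rw [card_coprime_congr_eq_card_units_fiber he s hu.unit hu.unit_spec, eq_div_iff hpos]
    exact_mod_cast card_units_fiber_mul_totient he hu.unit
  · rw [Nat.cast_eq_zero, Finset.card_eq_zero, Finset.filter_eq_empty_iff]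
    rintro k - ⟨hk, hd⟩
    apply h
    rw [← Int.isCoprime_iff_gcd_eq_one]
    have hke : IsCoprime (e : ℤ) (k : ℤ) :=
      Nat.isCoprime_iff_coprime.mpr (Nat.Coprime.coprime_dvd_right he hk).symm
    obtain ⟨c, hc⟩ := hd
    rw [show s = (k : ℤ) + e * (-c) by linarith]
    exact hke.add_mul_left_right (-c)

lemma ramanujanSum_eq_sum_ite {n : ℕ} (hn : 0 < n) (k : ℤ) :
    (ramanujanSum n k : ℚ) =
      ∑ e ∈ n.divisors, if (e : ℤ) ∣ k then (e : ℚ) * (moebius (n / e) : ℚ) else 0 := by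
  rw [← Finset.sum_filter, ramanujanSum]
  push_cast
  refine Finset.sum_congr ?_ fun _ _ => rfl
  ext e
  have hg : Int.gcd k n ≠ 0 := by simp [Int.gcd_eq_zero_iff, hn.ne']
  rw [Nat.mem_divisors, Finset.mem_filter, Nat.mem_divisors, Int.dvd_gcd_iff]
  simp [hg, hn.ne', Int.natCast_dvd_natCast, and_comm]

lemma ramanujanSum_eq_mul_moebius {n : ℕ} (hn : 0 < n) (s : ℤ) : (ramanujanSum n s : ℚ) =
    (idOnDivisors s * ((moebius : ArithmeticFunction ℤ) : ArithmeticFunction ℚ)) n := by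
  rw [ramanujanSum_eq_sum_ite hn, ArithmeticFunction.mul_apply,
    Nat.sum_divisorsAntidiagonal (fun x y => idOnDivisors s x *
      ((moebius : ArithmeticFunction ℤ) : ArithmeticFunction ℚ) y)]
  simp [idOnDivisors_apply, ite_mul]

lemma sum_coprime_filter_eq_mul_moebius (n : ℕ) (s : ℤ) :
    ∑ e ∈ n.divisors.filter (fun (e : ℕ) => Int.gcd (e : ℤ) s = 1),
        (e : ℚ) * (moebius (n / e) : ℚ) / (Nat.totient e : ℚ) =
      (coprimeDivTotient s * ((moebius : ArithmeticFunction ℤ) : ArithmeticFunction ℚ)) n := by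
  rw [ArithmeticFunction.mul_apply,
    Nat.sum_divisorsAntidiagonal (fun x y => coprimeDivTotient s x *
      ((moebius : ArithmeticFunction ℤ) : ArithmeticFunction ℚ) y), Finset.sum_filter]
  simp [coprimeDivTotient_apply, ite_mul, div_mul_eq_mul_div]

lemma sum_coprime_ramanujanSum_sub {n : ℕ} (hn : 0 < n) (s : ℤ) :
    (∑ k ∈ (Finset.Icc 1 n).filter (fun k => Nat.gcd k n = 1),
        (ramanujanSum n ((k : ℤ) - s) : ℚ))
      = (Nat.totient n : ℚ) *
        ∑ e ∈ n.divisors.filter (fun (e : ℕ) => Int.gcd (e : ℤ) s = 1),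
          (e : ℚ) * (moebius (n / e) : ℚ) / (Nat.totient e : ℚ) := by
  simp only [ramanujanSum_eq_sum_ite hn]
  rw [Finset.sum_comm, Finset.sum_filter, Finset.mul_sum]
  refine Finset.sum_congr rfl fun e he => ?_
  rw [← Finset.sum_filter, Finset.filter_filter, Finset.sum_const, nsmul_eq_mul,
    card_coprime_congr hn (Nat.dvd_of_mem_divisors he)]
  split_ifs <;> ring



/-- For a positive integer `n` and an integer `s`,
`∑_{1 ≤ k ≤ n, (k,n)=1} c_n (k - s) = φ n · ∑_{e ∣ n, (e,s)=1} e·μ(n/e)/φ e`,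
and this common value equals `μ(n)·c_n(s)` (the Brauer–Rademacher identity). -/
theorem ramanujan_sum_coprime_brauer_rademacher (n : ℕ) (hn : 0 < n) (s : ℤ) :
    (∑ k ∈ (Finset.Icc 1 n).filter (fun k => Nat.gcd k n = 1),
        (ramanujanSum n ((k : ℤ) - s) : ℚ))
      = (Nat.totient n : ℚ) *
        ∑ e ∈ n.divisors.filter (fun (e : ℕ) => Int.gcd (e : ℤ) s = 1),
          (e : ℚ) * (moebius (n / e) : ℚ) / (Nat.totient e : ℚ) ∧
    (∑ k ∈ (Finset.Icc 1 n).filter (fun k => Nat.gcd k n = 1),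
        (ramanujanSum n ((k : ℤ) - s) : ℚ))
      = (moebius n : ℚ) * (ramanujanSum n s : ℚ) := by
  have h := sum_coprime_ramanujanSum_sub hn s
  refine ⟨h, ?_⟩
  rw [h, sum_coprime_filter_eq_mul_moebius, ramanujanSum_eq_mul_moebius hn]
  exact DFunLike.congr_fun (totientRat_pmul_eq_moebius_pmul s) n
end

section
/- Let χ be a Dirichlet character (mod n) with conductor d (so d ∣ n), let χ* be the primitive character (mod d) inducing χ, and let s be an integer. Then Σ_{k=1}^{n} gcd(k − s, n) χ(k) = φ(n) · χ*(s) · #{δ : δ ∣ n/d and gcd(δ, s) = 1}. -/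
open Finset

/-- The sum of a homomorphism to an integral domain over a fibre of a surjective group
homomorphism. -/
theorem card_mul_sum_fiber_of_surjective {G H R : Type*} [Group G] [Fintype G] [Group H]
    [DecidableEq H] [CommRing R] [IsDomain R] (f : G →* H) (hf : Function.Surjective f)
    (ψ : G →* R) (g₀ : G) [Decidable (∀ g, f g = 1 → ψ g = 1)] :
    (Nat.card H : R) * ∑ g with f g = f g₀, ψ g =
      if ∀ g, f g = 1 → ψ g = 1 then (Nat.card G : R) * ψ g₀ else 0 := by
  classical
  have hsum : ∑ g with f g = f g₀, ψ g = ψ g₀ * ∑ k : f.ker, (ψ.comp f.ker.subtype) k := by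
    rw [Finset.mul_sum]
    symm
    refine Finset.sum_bij (fun k _ => g₀ * (k : G)) ?_ ?_ ?_ ?_
    · intro k _
      have hk := k.2
      rw [MonoidHom.mem_ker] at hk
      simp [hk]
    · intro a _ b _ hab
      exact Subtype.ext (mul_left_cancel hab)
    · intro g hg
      refine ⟨⟨g₀⁻¹ * g, ?_⟩, Finset.mem_univ _, by simp⟩
      rw [MonoidHom.mem_ker]
      simp [(Finset.mem_filter.1 hg).2]
    · intro k _
      simp
  have htriv : ψ.comp f.ker.subtype = 1 ↔ ∀ g, f g = 1 → ψ g = 1 :=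
    ⟨fun h g hg => DFunLike.congr_fun h (⟨g, hg⟩ : f.ker),
      fun h => MonoidHom.ext fun k => h k k.2⟩
  have hcard : Nat.card H * Nat.card f.ker = Nat.card G := by
    rw [← f.ker.card_mul_index, Subgroup.index_ker, MonoidHom.range_eq_top.2 hf,
      Subgroup.card_top, mul_comm]
  rw [hsum, sum_hom_units]
  simp only [htriv]
  split_ifs
  · rw [← hcard, ← Nat.card_eq_fintype_card]
    push_cast
    ring
  · simp

theorem Int.gcd_eq_sum_totient (a : ℤ) {n : ℕ} (hn : n ≠ 0) :
    Int.gcd a n = ∑ e ∈ n.divisors with ((e : ℕ) : ℤ) ∣ a, e.totient := by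
  rw [← Nat.sum_totient (Int.gcd a n)]
  refine Finset.sum_congr ?_ fun _ _ => rfl
  ext e
  simp only [Nat.mem_divisors, Finset.mem_filter, Int.gcd_eq_natAbs, Int.natAbs_natCast,
    Nat.dvd_gcd_iff, Int.natCast_dvd, ne_eq, Nat.gcd_eq_zero_iff]
  tauto

theorem ZMod.sum_Icc_natCast {M : Type*} [AddCommMonoid M] (n : ℕ) [NeZero n] (F : ZMod n → M) :
    ∑ k ∈ Finset.Icc 1 n, F k = ∑ x, F x := by
  have hinj : Set.InjOn (fun k : ℕ => (k : ZMod n)) (Finset.Icc 1 n) := by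
    intro a ha b hb hab
    simp only [Finset.coe_Icc, Set.mem_Icc] at ha hb
    refine ((ZMod.natCast_eq_natCast_iff a b n).1 hab).eq_of_abs_lt ?_
    rw [abs_lt]
    omega
  refine Finset.sum_nbij (fun k : ℕ => (k : ZMod n)) (by simp) hinj ?_ fun _ _ => rfl
  exact Finset.surjOn_of_injOn_of_card_le _ (by simp [Set.MapsTo]) hinj (by simp [ZMod.card])

theorem Fintype.sum_eq_sum_units {M A : Type*} [Monoid M] [Fintype M] [Fintype Mˣ]
    [AddCommMonoid A] (F : M → A) (hF : ∀ x, ¬ IsUnit x → F x = 0) :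
    ∑ x, F x = ∑ u : Mˣ, F u := by
  symm
  refine Fintype.sum_of_injective Units.val Units.val_injective _ _ (fun x hx => hF x ?_)
    fun _ => rfl
  rintro ⟨u, rfl⟩
  exact hx ⟨u, rfl⟩

theorem DirichletCharacter.forall_unitsMap_eq_one_iff_conductor_dvd {R : Type*}
    [CommMonoidWithZero R] {n e : ℕ} [NeZero n] (χ : DirichletCharacter R n) (he : e ∣ n) :
    (∀ u : (ZMod n)ˣ, ZMod.unitsMap he u = 1 → χ u = 1) ↔ χ.conductor ∣ e := by
  rw [← χ.mem_conductorSet_iff_conductor_dvd he, DirichletCharacter.mem_conductorSet_iff,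
    DirichletCharacter.factorsThrough_iff_ker_unitsMap he]
  refine forall_congr' fun u => ?_
  rw [MonoidHom.mem_ker, MonoidHom.mem_ker, ← Units.val_inj (a := χ.toUnitHom u)]
  simp

theorem DirichletCharacter.totient_mul_sum_cast_eq {R : Type*} [CommRing R] [IsDomain R]
    {n d e : ℕ} [NeZero n] (hd : d ∣ n) (he : e ∣ n) (χ : DirichletCharacter R n)
    (χstar : DirichletCharacter R d) (hcond : χ.conductor = d)
    (hind : χ = DirichletCharacter.changeLevel hd χstar) (s : ℤ) :
    (e.totient : R) * ∑ x : ZMod n with (x.cast : ZMod e) = s, χ x =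
      if d ∣ e ∧ Int.gcd e s = 1 then (n.totient : R) * χstar s else 0 := by
  classical
  have : NeZero e := ⟨fun h => NeZero.ne n (Nat.eq_zero_of_zero_dvd (h ▸ he))⟩
  have hunits : ∑ x : ZMod n with (x.cast : ZMod e) = s, χ x =
      ∑ u : (ZMod n)ˣ with ((ZMod.unitsMap he u : (ZMod e)ˣ) : ZMod e) = s, χ u := by
    rw [Finset.sum_filter, Finset.sum_filter,
      Fintype.sum_eq_sum_units _ fun x hx => by rw [χ.map_nonunit hx, ite_self]]
    rfl
  have hs : IsUnit (s : ZMod e) ↔ Int.gcd e s = 1 := by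
    rw [ZMod.coe_int_isUnit_iff_isCoprime, Int.isCoprime_iff_gcd_eq_one]
  rw [hunits]
  by_cases hgcd : Int.gcd e s = 1
  · obtain ⟨v, hv⟩ := hs.2 hgcd
    obtain ⟨g₀, rfl⟩ := ZMod.unitsMap_surjective he v
    have key := card_mul_sum_fiber_of_surjective (ZMod.unitsMap he)
      (ZMod.unitsMap_surjective he) ((χ : ZMod n →* R).comp (Units.coeHom (ZMod n))) g₀
    simp only [Nat.card_eq_fintype_card, ZMod.card_units_eq_totient, MonoidHom.comp_apply,
      Units.coeHom_apply, MonoidHom.coe_coe] at key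
    simp only [← hv, Units.val_inj, hgcd, and_true]
    refine key.trans ?_
    simp only [χ.forall_unitsMap_eq_one_iff_conductor_dvd he, hcond]
    refine if_ctx_congr Iff.rfl (fun hde => ?_) fun _ => rfl
    rw [hind, DirichletCharacter.changeLevel_eq_cast_of_dvd]
    congr 2
    rw [← map_intCast (ZMod.castHom hde (ZMod d)) s, ← hv]
    exact (RingHom.congr_fun (ZMod.castHom_comp hde he) (g₀ : ZMod n)).symm
  · rw [if_neg fun h => hgcd h.2, Finset.filter_false_of_mem, Finset.sum_empty, mul_zero]
    exact fun u _ hu => hgcd (hs.1 (hu ▸ Units.isUnit _))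

theorem Nat.card_filter_dvd_gcd_eq_one {n d : ℕ} (hn : n ≠ 0) (hd : d ∣ n) {s : ℤ}
    (hs : Int.gcd d s = 1) :
    #{e ∈ n.divisors | d ∣ e ∧ Int.gcd ((e : ℕ) : ℤ) s = 1} =
      #{δ ∈ (n / d).divisors | Int.gcd ((δ : ℕ) : ℤ) s = 1} := by
  obtain ⟨m, rfl⟩ := hd
  have hd0 : d ≠ 0 := left_ne_zero_of_mul hn
  have hm0 : m ≠ 0 := right_ne_zero_of_mul hn
  rw [Nat.mul_div_cancel_left m (Nat.pos_of_ne_zero hd0)]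
  have hmul (δ : ℕ) : Int.gcd ((d * δ : ℕ) : ℤ) s = 1 ↔ Int.gcd (δ : ℤ) s = 1 := by
    rw [← Int.isCoprime_iff_gcd_eq_one, ← Int.isCoprime_iff_gcd_eq_one, Nat.cast_mul,
      IsCoprime.mul_left_iff, and_iff_right (Int.isCoprime_iff_gcd_eq_one.2 hs)]
  symm
  refine Finset.card_nbij (d * ·) ?_ (mul_right_injective₀ hd0).injOn ?_
  · intro δ hδ
    simp only [Finset.coe_filter, Nat.mem_divisors, Set.mem_ofPred_eq] at hδ ⊢
    exact ⟨⟨mul_dvd_mul_left d hδ.1.1, hn⟩, dvd_mul_right d δ, (hmul δ).2 hδ.2⟩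
  · rintro e he
    simp only [Finset.coe_filter, Nat.mem_divisors, Set.mem_ofPred_eq] at he
    obtain ⟨⟨hdvd, -⟩, ⟨δ, rfl⟩, hδ⟩ := he
    refine ⟨δ, ?_, rfl⟩
    simp only [Finset.coe_filter, Nat.mem_divisors, Set.mem_ofPred_eq]
    exact ⟨⟨Nat.dvd_of_mul_dvd_mul_left (Nat.pos_of_ne_zero hd0) hdvd, hm0⟩, (hmul δ).1 hδ⟩

/-- **Corollary (Menon's identity with Dirichlet characters, shifted)**.
Let `χ` be a Dirichlet character (mod `n`) with conductor `d` (so `d ∣ n`), let `χ*` be the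
primitive character (mod `d`) inducing `χ`, and let `s` be an integer.  Then
`∑_{k=1}^{n} gcd (k - s) n · χ(k) = φ n · χ*(s) · #{δ : δ ∣ n/d, (δ,s)=1}`. -/
theorem menon_dirichlet_character_gcd (n d : ℕ) (hn : 0 < n) (hd : d ∣ n)
    (χ : DirichletCharacter ℂ n) (χstar : DirichletCharacter ℂ d)
    (hcond : χ.conductor = d) (hprim : χstar.IsPrimitive)
    (hind : χ = DirichletCharacter.changeLevel hd χstar) (s : ℤ) :
    ∑ k ∈ Finset.Icc 1 n, (Int.gcd ((k : ℤ) - s) (n : ℤ) : ℂ) * χ (k : ZMod n)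
      = (Nat.totient n : ℂ) * χstar ((s : ℤ) : ZMod d) *
        (((n / d).divisors.filter (fun (δ : ℕ) => Int.gcd (δ : ℤ) s = 1)).card : ℂ) := by
  have : NeZero n := ⟨hn.ne'⟩
  have hterm (k : ℕ) : (Int.gcd ((k : ℤ) - s) (n : ℤ) : ℂ) * χ (k : ZMod n) =
      ∑ e ∈ n.divisors,
        if (((k : ZMod n).cast : ZMod e) = s) then (e.totient : ℂ) * χ (k : ZMod n) else 0 := by
    rw [Int.gcd_eq_sum_totient _ hn.ne', Finset.sum_filter, Nat.cast_sum, Finset.sum_mul]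
    refine Finset.sum_congr rfl fun e he => ?_
    have hk : (((k : ZMod n).cast : ZMod e) = s) ↔ (e : ℤ) ∣ (k : ℤ) - s := by
      rw [ZMod.cast_natCast (Nat.dvd_of_mem_divisors he), ← ZMod.intCast_zmod_eq_zero_iff_dvd,
        Int.cast_sub, sub_eq_zero, Int.cast_natCast]
    simp only [hk]
    split_ifs <;> simp
  simp only [hterm]
  rw [ZMod.sum_Icc_natCast n fun x : ZMod n => ∑ e ∈ n.divisors,
    if ((x.cast : ZMod e) = s) then (e.totient : ℂ) * χ x else 0, Finset.sum_comm]
  have hdiv : ∀ e ∈ n.divisors,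
      (∑ x : ZMod n, if ((x.cast : ZMod e) = s) then (e.totient : ℂ) * χ x else 0) =
        if d ∣ e ∧ Int.gcd e s = 1 then (n.totient : ℂ) * χstar s else 0 := fun e he => by
    rw [← χ.totient_mul_sum_cast_eq hd (Nat.dvd_of_mem_divisors he) χstar hcond hind s,
      ← Finset.sum_filter, Finset.mul_sum]
  rw [Finset.sum_congr rfl hdiv, ← Finset.sum_filter, Finset.sum_const, nsmul_eq_mul, mul_comm]
  by_cases hs : Int.gcd d s = 1
  · rw [Nat.card_filter_dvd_gcd_eq_one hn.ne' hd hs]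
  · have hzero : χstar (s : ZMod d) = 0 := by
      rw [DirichletCharacter.apply_eq_zero_iff, Int.isCoprime_iff_gcd_eq_one, Int.gcd_comm]
      exact hs
    simp [hzero]
end

section
/- Let χ be a Dirichlet character (mod n) with conductor d (so d ∣ n), let χ* be the primitive character (mod d) inducing χ, and let s be an integer. Then Σ_{k=1}^{n} c_n(k − s) χ(k) = d · φ(n) · χ*(s) · Σ_{δ ∣ n/d, gcd(δ,s)=1} δ · μ(n/(δd)) / φ(δd). -/
open Finset ArithmeticFunction

/-- The fibres of a surjective homomorphism of finite groups all have the same size. -/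
theorem card_fiber_mul_card_of_surjective {G H : Type*} [Group G] [Group H] [Fintype G]
    [Fintype H] [DecidableEq H] (f : G →* H) (hf : Function.Surjective f) (h : H) :
    #{g | f g = h} * Fintype.card H = Fintype.card G := by
  have hfib (h' : H) : #{g | f g = h'} = #{g | f g = h} := by
    obtain ⟨a, rfl⟩ := hf h
    obtain ⟨b, rfl⟩ := hf h'
    refine Finset.card_equiv (Equiv.mulLeft (a * b⁻¹)) fun g ↦ ?_
    simp [inv_mul_eq_iff_eq_mul]
  have hsum := Finset.card_eq_sum_card_fiberwise (f := f) (s := Finset.univ) (t := Finset.univ)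
    (by simp)
  rw [Finset.sum_congr rfl fun h' _ ↦ hfib h'] at hsum
  simpa [mul_comm] using hsum.symm

/-- A sum over a complete residue system, as a sum over `ZMod n`. -/
theorem sum_Icc_natCast_zmod {M : Type*} [AddCommMonoid M] (n : ℕ) [NeZero n]
    (f : ZMod n → M) : ∑ k ∈ Finset.Icc 1 n, f (k : ZMod n) = ∑ x, f x := by
  have hsurj : Set.SurjOn (fun k : ℕ ↦ (k : ZMod n)) (Finset.Icc 1 n)
      (Finset.univ : Finset (ZMod n)) := by
    intro x _
    by_cases hx : x = 0
    · exact ⟨n, by simpa using NeZero.one_le, by simp [hx]⟩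
    · refine ⟨x.val, ?_, ZMod.natCast_zmod_val x⟩
      simpa using ⟨Nat.one_le_iff_ne_zero.mpr ((ZMod.val_ne_zero x).mpr hx), x.val_lt.le⟩
  exact Finset.sum_nbij _ (by simp)
    (Finset.injOn_of_surjOn_of_card_le _ (by simp [Set.MapsTo]) hsurj (by simp)) hsurj
    (fun _ _ ↦ rfl)

namespace DirichletCharacter

variable {n : ℕ} [NeZero n]

/-- A sum of a Dirichlet character over a set of residues is a sum over the units in that set. -/
theorem sum_ite_eq_sum_units (χ : DirichletCharacter ℂ n) (p : ZMod n → Prop) [DecidablePred p] :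
    ∑ x, (if p x then χ x else 0) = ∑ u : (ZMod n)ˣ, if p u then χ u else 0 := by
  refine (Finset.sum_of_injOn (fun u : (ZMod n)ˣ ↦ (u : ZMod n))
    Units.val_injective.injOn (by simp) (fun x _ hx ↦ ?_) (fun _ _ ↦ rfl)).symm
  have hx' : ¬ IsUnit x := fun ⟨u, hu⟩ ↦ hx ⟨u, by simp, hu⟩
  simp [χ.map_nonunit hx']

/-- The sum of a Dirichlet character over a residue class modulo `e ∣ n` vanishes unless its
conductor divides `e`. -/
theorem sum_units_fiber_eq_zero (χ : DirichletCharacter ℂ n) {e : ℕ} (he : e ∣ n)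
    (h : ¬ χ.conductor ∣ e) (v : (ZMod e)ˣ) :
    ∑ u : (ZMod n)ˣ, (if ZMod.unitsMap he u = v then χ u else 0) = 0 := by
  rw [← mem_conductorSet_iff_conductor_dvd χ he, mem_conductorSet_iff,
    factorsThrough_iff_ker_unitsMap he, SetLike.not_le_iff_exists] at h
  obtain ⟨g, hg, hχ⟩ := h
  rw [MonoidHom.mem_ker] at hg hχ
  have hχg : χ g ≠ 1 := fun h1 ↦ hχ (Units.ext (by simpa using h1))
  have key : χ g * ∑ u : (ZMod n)ˣ, (if ZMod.unitsMap he u = v then χ u else 0)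
      = ∑ u : (ZMod n)ˣ, (if ZMod.unitsMap he u = v then χ u else 0) := by
    rw [Finset.mul_sum]
    exact Fintype.sum_equiv (Equiv.mulLeft g) _ _ fun u ↦ by simp [hg]
  exact (mul_left_eq_self₀.mp key).resolve_left hχg

/-- The sum of a Dirichlet character over the units in a residue class modulo `e`, when the
character is induced from a level `d ∣ e`. -/
theorem sum_units_fiber_changeLevel {d e : ℕ} (ψ : DirichletCharacter ℂ d) (hde : d ∣ e)
    (he : e ∣ n) (v : (ZMod e)ˣ) :
    ∑ u : (ZMod n)ˣ, (if ZMod.unitsMap he u = v then changeLevel (hde.trans he) ψ u else 0)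
      = (n.totient : ℂ) / e.totient * changeLevel hde ψ v := by
  have : NeZero e := ⟨ne_zero_of_dvd_ne_zero (NeZero.ne n) he⟩
  have hcard := card_fiber_mul_card_of_surjective _ (ZMod.unitsMap_surjective he) v
  rw [ZMod.card_units_eq_totient, ZMod.card_units_eq_totient] at hcard
  have hpos : (e.totient : ℂ) ≠ 0 := by
    exact_mod_cast (Nat.totient_pos.mpr (NeZero.pos e)).ne'
  have hval (u : (ZMod n)ˣ) : (if ZMod.unitsMap he u = v then changeLevel (hde.trans he) ψ u else 0)
      = if ZMod.unitsMap he u = v then changeLevel hde ψ v else 0 := by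
    split_ifs with h
    · rw [changeLevel_trans ψ hde he, changeLevel_eq_cast_of_dvd _ he, ← h, ZMod.unitsMap_val]
    · rfl
  rw [Finset.sum_congr rfl fun u _ ↦ hval u, ← Finset.sum_filter, Finset.sum_const, nsmul_eq_mul,
    ← hcard]
  push_cast
  field_simp

/-- The sum of a Dirichlet character modulo `n`, induced by a character `ψ` whose level is the
conductor, over a residue class modulo a divisor `e` of `n`. -/
theorem sum_residue_class {d e : ℕ} (ψ : DirichletCharacter ℂ d) (hd : d ∣ n) (he : e ∣ n)
    (hcond : (changeLevel hd ψ).conductor = d) (s : ℤ) :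
    ∑ x : ZMod n, (if ZMod.castHom he (ZMod e) x = s then changeLevel hd ψ x else 0)
      = if d ∣ e ∧ IsCoprime s e then (n.totient : ℂ) / e.totient * ψ s else 0 := by
  rw [sum_ite_eq_sum_units]
  by_cases hs : IsCoprime s e
  · have hunit (u : (ZMod n)ˣ) : ZMod.castHom he (ZMod e) u = s ↔
        ZMod.unitsMap he u = ZMod.unitOfIsCoprime s hs := by
      rw [Units.ext_iff, ZMod.coe_unitOfIsCoprime, ZMod.unitsMap_val, ZMod.castHom_apply]
    simp_rw [hunit]
    split_ifs with h
    · rw [sum_units_fiber_changeLevel ψ h.1 he, ZMod.coe_unitOfIsCoprime,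
        changeLevel_eq_cast_of_dvd' ψ h.1 hs]
    · exact sum_units_fiber_eq_zero _ he (by rw [hcond]; tauto) _
  · rw [if_neg (by tauto)]
    refine Finset.sum_eq_zero fun u _ ↦ if_neg fun h ↦ hs ?_
    rw [isCoprime_comm, ← ZMod.coe_int_isUnit_iff_isCoprime, ← h]
    exact u.isUnit.map _

end DirichletCharacter

/-- The Ramanujan sum as a sum over all divisors of the modulus. -/
theorem ramanujanSum_eq_sum_divisors {n : ℕ} (hn : n ≠ 0) (k : ℤ) :
    ramanujanSum n k =
      ∑ e ∈ n.divisors, if (e : ℤ) ∣ k then (e : ℤ) * moebius (n / e) else 0 := by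
  rw [ramanujanSum, ← Finset.sum_filter]
  refine Finset.sum_congr ?_ fun _ _ ↦ rfl
  ext e
  simp [hn, Nat.dvd_gcd_iff, Int.gcd, Int.natCast_dvd, and_comm]

/-- A sum over the divisors of `n` supported on multiples of `d ∣ n`. -/
theorem sum_divisors_eq_sum_divisors_div {M : Type*} [AddCommMonoid M] {n d : ℕ} (hn : n ≠ 0)
    (hd : d ∣ n) (f : ℕ → M) (hf : ∀ e, ¬ d ∣ e → f e = 0) :
    ∑ e ∈ n.divisors, f e = ∑ δ ∈ (n / d).divisors, f (δ * d) := by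
  obtain ⟨m, rfl⟩ := hd
  obtain ⟨hd0, hm0⟩ := mul_ne_zero_iff.mp hn
  rw [Nat.mul_div_cancel_left m (Nat.pos_of_ne_zero hd0)]
  refine (Finset.sum_of_injOn (· * d) (fun a _ b _ h ↦ mul_right_cancel₀ hd0 h)
    (fun a ha ↦ ?_) (fun e he hne ↦ hf e ?_) (fun _ _ ↦ rfl)).symm
  · have ha' := Nat.dvd_of_mem_divisors ha
    simpa [hd0, hm0, mul_comm d] using Nat.mul_dvd_mul_right ha' d
  · rintro ⟨a, rfl⟩
    refine hne ⟨a, ?_, mul_comm _ _⟩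
    simpa [hm0] using Nat.dvd_of_mul_dvd_mul_left (Nat.pos_of_ne_zero hd0)
      (Nat.dvd_of_mem_divisors he)

/-- **Corollary (Menon-type identity with Dirichlet characters and Ramanujan sums)**.
Let `χ` be a Dirichlet character (mod `n`) with conductor `d` (so `d ∣ n`), let `χ*` be the
primitive character (mod `d`) inducing `χ`, and let `s` be an integer.  Then
`∑_{k=1}^{n} c_n (k - s) χ(k) = d · φ n · χ*(s) · ∑_{δ ∣ n/d, (δ,s)=1} δ·μ(n/(δd))/φ(δd)`. -/
theorem menon_dirichlet_character_ramanujan (n d : ℕ) (hn : 0 < n) (hd : d ∣ n)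
    (χ : DirichletCharacter ℂ n) (χstar : DirichletCharacter ℂ d)
    (hcond : χ.conductor = d) (hprim : χstar.IsPrimitive)
    (hind : χ = DirichletCharacter.changeLevel hd χstar) (s : ℤ) :
    ∑ k ∈ Finset.Icc 1 n, (ramanujanSum n ((k : ℤ) - s) : ℂ) * χ (k : ZMod n)
      = (d : ℂ) * (Nat.totient n : ℂ) * χstar ((s : ℤ) : ZMod d) *
        ∑ δ ∈ (n / d).divisors.filter (fun (δ : ℕ) => Int.gcd (δ : ℤ) s = 1),
          (δ : ℂ) * (moebius (n / (δ * d)) : ℂ) / (Nat.totient (δ * d) : ℂ) := by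
  have : NeZero n := ⟨hn.ne'⟩
  subst hind
  set χ := DirichletCharacter.changeLevel hd χstar
  have hclass (e : ℕ) (he : e ∈ n.divisors) :
      ∑ k ∈ Finset.Icc 1 n, (if (e : ℤ) ∣ (k : ℤ) - s then χ (k : ZMod n) else 0)
        = if d ∣ e ∧ IsCoprime s e then (n.totient : ℂ) / e.totient * χstar s else 0 := by
    have hen := Nat.dvd_of_mem_divisors he
    rw [← DirichletCharacter.sum_residue_class χstar hd hen hcond s, ← sum_Icc_natCast_zmod]
    refine Finset.sum_congr rfl fun k _ ↦ if_congr ?_ rfl rfl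
    rw [map_natCast, ← ZMod.intCast_zmod_eq_zero_iff_dvd, Int.cast_sub, sub_eq_zero,
      Int.cast_natCast]
  calc
    _ = ∑ e ∈ n.divisors, ((e : ℂ) * (moebius (n / e) : ℂ)) *
          ∑ k ∈ Finset.Icc 1 n, (if (e : ℤ) ∣ (k : ℤ) - s then χ (k : ZMod n) else 0) := by
      simp_rw [Finset.mul_sum]
      rw [Finset.sum_comm]
      refine Finset.sum_congr rfl fun k _ ↦ ?_
      rw [ramanujanSum_eq_sum_divisors hn.ne', Int.cast_sum, Finset.sum_mul]
      refine Finset.sum_congr rfl fun e _ ↦ ?_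
      split_ifs <;> simp
    _ = ∑ e ∈ n.divisors, ((e : ℂ) * (moebius (n / e) : ℂ)) *
          if d ∣ e ∧ IsCoprime s e then (n.totient : ℂ) / e.totient * χstar s else 0 :=
      Finset.sum_congr rfl fun e he ↦ by rw [hclass e he]
    _ = _ := by
      rw [sum_divisors_eq_sum_divisors_div hn.ne' hd _ fun e he ↦ by simp [he], Finset.sum_filter,
        Finset.mul_sum]
      refine Finset.sum_congr rfl fun δ _ ↦ ?_
      have hδ : Int.gcd (δ : ℤ) s = 1 ↔ IsCoprime s (δ : ℤ) := by
        rw [isCoprime_comm, Int.isCoprime_iff_gcd_eq_one]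
      by_cases hs : IsCoprime s (d : ℤ)
      · simp only [dvd_mul_left, true_and, Nat.cast_mul, IsCoprime.mul_right_iff, hs, and_true, hδ]
        split_ifs
        · ring
        · simp
      · simp [(χstar.apply_eq_zero_iff s).mpr hs]
end

section
/- Let n be a positive integer and s an integer. Then Σ_{1 ≤ k ≤ n, gcd(k,n)=1} gcd(k − s, n) = φ(n) · #{δ : δ ∣ n and gcd(δ, s) = 1}. In particular, if gcd(s, n) = 1 then this sum equals φ(n)·τ(n). -/
open Finset

/-- The residues coprime to `n` in `[1, n]` enumerate the units of `ZMod n`. -/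
theorem sum_coprime_eq_sum_units {M : Type*} [AddCommMonoid M] (n : ℕ) [NeZero n]
    (f : ZMod n → M) :
    ∑ k ∈ (Icc 1 n).filter (fun k => Nat.gcd k n = 1), f (k : ZMod n) =
      ∑ u : (ZMod n)ˣ, f u := by
  refine sum_bij (fun k hk => ZMod.unitOfCoprime k (mem_filter.mp hk).2) (by simp) ?_ ?_ ?_
  · intro a ha b hb hab
    simp only [mem_filter, mem_Icc] at ha hb
    have h := congrArg (Units.val) hab
    simp only [ZMod.coe_unitOfCoprime, ZMod.natCast_eq_natCast_iff] at h
    have h' : a - 1 ≡ b - 1 [MOD n] := by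
      apply Nat.ModEq.add_right_cancel' 1
      rwa [Nat.sub_add_cancel ha.1.1, Nat.sub_add_cancel hb.1.1]
    have := h'.eq_of_lt_of_lt (by omega) (by omega)
    omega
  · intro u _
    have hu := ZMod.val_coe_unit_coprime u
    have hlt := ZMod.val_lt (u : ZMod n)
    by_cases h0 : (u : ZMod n).val = 0
    · rw [h0, Nat.coprime_zero_left] at hu
      subst hu
      exact ⟨1, by simp, Subsingleton.elim _ _⟩
    · refine ⟨(u : ZMod n).val, ?_, ?_⟩
      · simp only [mem_filter, mem_Icc]
        exact ⟨⟨by omega, hlt.le⟩, hu⟩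
      · ext
        simp
  · simp

/-- Every coprime residue class modulo a divisor `d` of `n` lifts to `φ n / φ d` units
modulo `n`. -/
theorem totient_mul_card_fiber_unitsMap {d n : ℕ} [NeZero n] [NeZero d] (h : d ∣ n)
    (v : (ZMod d)ˣ) :
    Nat.totient d * (univ.filter (fun u => ZMod.unitsMap h u = v)).card = Nat.totient n := by
  have hs := ZMod.unitsMap_surjective h
  have hc := card_eq_sum_card_fiberwise (f := ZMod.unitsMap h) (s := univ) (t := univ) (by simp)
  rw [sum_congr rfl fun w _ =>
    MonoidHom.card_fiber_eq_of_mem_range (ZMod.unitsMap h) (hs w) (hs v)] at hc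
  rw [← ZMod.card_units_eq_totient n, ← ZMod.card_units_eq_totient d,
    ← card_univ (α := (ZMod n)ˣ), hc]
  simp

theorem totient_mul_card_coprime_modEq {d n : ℕ} (hn : 0 < n) (h : d ∣ n) (s : ℤ) :
    Nat.totient d *
      (((Icc 1 n).filter (fun k => Nat.gcd k n = 1)).filter
        (fun k : ℕ => (d : ℤ) ∣ (k : ℤ) - s)).card =
      if Int.gcd (d : ℤ) s = 1 then Nat.totient n else 0 := by
  have : NeZero n := ⟨hn.ne'⟩
  have : NeZero d := ⟨(Nat.pos_of_dvd_of_pos h hn).ne'⟩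
  have hiff (k : ℕ) : (d : ℤ) ∣ (k : ℤ) - s ↔
      ZMod.castHom h (ZMod d) (k : ZMod n) = (s : ZMod d) := by
    rw [map_natCast, ← ZMod.intCast_zmod_eq_zero_iff_dvd, Int.cast_sub, sub_eq_zero,
      Int.cast_natCast]
  split_ifs with hs
  · have hu : IsUnit (s : ZMod d) := by
      rw [ZMod.coe_int_isUnit_iff_isCoprime, Int.isCoprime_iff_gcd_eq_one]
      exact hs
    obtain ⟨v, hv⟩ := hu
    rw [← totient_mul_card_fiber_unitsMap h v, card_filter, card_filter]
    simp only [hiff]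
    rw [sum_coprime_eq_sum_units n fun x =>
      if ZMod.castHom h (ZMod d) x = (s : ZMod d) then 1 else 0]
    simp only [Units.ext_iff, hv]
    rfl
  · rw [mul_eq_zero, card_eq_zero, filter_eq_empty_iff]
    right
    intro k hk hd
    simp only [mem_filter] at hk
    apply hs
    rw [← Int.isCoprime_iff_gcd_eq_one]
    have hk' : IsCoprime (d : ℤ) (k : ℤ) :=
      Nat.isCoprime_iff_coprime.mpr (Nat.Coprime.of_dvd_left h (Nat.Coprime.symm hk.2))
    obtain ⟨c, hc⟩ := hd
    have : s = k + d * (-c) := by linarith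
    rw [this]
    exact hk'.add_mul_left_right _

theorem gcd_eq_sum_divisors_totient {n : ℕ} (hn : 0 < n) (a : ℤ) :
    Int.gcd a (n : ℤ) = ∑ d ∈ n.divisors, if (d : ℤ) ∣ a then Nat.totient d else 0 := by
  conv_lhs => rw [← Nat.sum_totient (Int.gcd a n)]
  rw [← sum_filter]
  refine sum_congr ?_ fun _ _ => rfl
  ext d
  simp only [Nat.mem_divisors, mem_filter, Int.dvd_gcd_iff, Int.natCast_dvd_natCast, ne_eq,
    Int.gcd_eq_zero_iff]
  grind


/-- For a positive integer `n` and an integer `s`,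
`∑_{1 ≤ k ≤ n, (k,n)=1} gcd (k - s) n = φ n · #{δ : δ ∣ n, (δ,s)=1}`.
In particular, if `gcd s n = 1`, this sum equals `φ n · τ n`. -/
theorem menon_shifted_identity (n : ℕ) (hn : 0 < n) (s : ℤ) :
    (∑ k ∈ (Finset.Icc 1 n).filter (fun k => Nat.gcd k n = 1),
        Int.gcd ((k : ℤ) - s) (n : ℤ))
      = Nat.totient n * (n.divisors.filter (fun (δ : ℕ) => Int.gcd (δ : ℤ) s = 1)).card ∧
    (Int.gcd s (n : ℤ) = 1 →
      (∑ k ∈ (Finset.Icc 1 n).filter (fun k => Nat.gcd k n = 1),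
          Int.gcd ((k : ℤ) - s) (n : ℤ))
        = Nat.totient n * n.divisors.card) := by
  have key : (∑ k ∈ (Finset.Icc 1 n).filter (fun k => Nat.gcd k n = 1),
        Int.gcd ((k : ℤ) - s) (n : ℤ))
      = Nat.totient n * (n.divisors.filter (fun (δ : ℕ) => Int.gcd (δ : ℤ) s = 1)).card := by
    simp only [gcd_eq_sum_divisors_totient hn]
    rw [sum_comm, card_filter, mul_sum]
    refine sum_congr rfl fun d hd => ?_
    rw [← sum_filter, sum_const, smul_eq_mul, mul_comm,
      totient_mul_card_coprime_modEq hn (Nat.dvd_of_mem_divisors hd), mul_ite, mul_one, mul_zero]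
  refine ⟨key, fun hs => ?_⟩
  rw [key, filter_true_of_mem]
  intro d hd
  rw [← Int.isCoprime_iff_gcd_eq_one] at hs ⊢
  exact (hs.of_isCoprime_of_dvd_right
    (Int.natCast_dvd_natCast.mpr (Nat.dvd_of_mem_divisors hd))).symm
end
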